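/- For any basis (X, Y) of the free group F(A,B), the commutator XYX⁻¹Y⁻¹ is conjugate in F(A,B) to ABA⁻¹B⁻¹ or to BAB⁻¹A⁻¹. -/

import Mathlib

abbrev F2 := FreeGroup Bool

def A : F2 := FreeGroup.of true

def B : F2 := FreeGroup.of false

/-- `(x, y)` is a basis (free generating pair) of the free group `F2 = F(A,B)`. -/
def IsBasis (x y : F2) : Prop := ∃ e : F2 ≃* F2, e A = x ∧ e B = y

/-- `w` is primitive: it is part of some basis of `F2`. -/
def IsPrimitive (w : F2) : Prop := ∃ x y : F2, IsBasis x y ∧ (w = x ∨ w = y)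

section CommonPrefix

/-- The length of the longest common prefix of two lists. -/
def commonPrefixLength {α : Type*} [DecidableEq α] : List α → List α → ℕ
  | a :: l, b :: m => if a = b then commonPrefixLength l m + 1 else 0
  | [], _ => 0
  | _ :: _, [] => 0

variable {α : Type*} [DecidableEq α]

theorem commonPrefixLength_comm (l m : List α) :
    commonPrefixLength l m = commonPrefixLength m l := by
  induction l generalizing m with
  | nil => cases m <;> rfl
  | cons a l ih =>
    cases m with
    | nil => rfl
    | cons b m => simp only [commonPrefixLength, ih m, eq_comm]

theorem min_commonPrefixLength_le (l m n : List α) :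
    min (commonPrefixLength l m) (commonPrefixLength m n) ≤ commonPrefixLength l n := by
  induction l generalizing m n with
  | nil => simp [commonPrefixLength]
  | cons a l ih =>
    cases m with
    | nil => simp [commonPrefixLength]
    | cons b m =>
      cases n with
      | nil => simp [commonPrefixLength]
      | cons c n =>
        have := ih m n
        simp only [commonPrefixLength]
        split_ifs <;> first | omega | simp_all

theorem take_commonPrefixLength (l m : List α) :
    l.take (commonPrefixLength l m) = m.take (commonPrefixLength l m) := by
  induction l generalizing m with
  | nil => simp [commonPrefixLength]
  | cons a l ih =>
    cases m with
    | nil => simp [commonPrefixLength]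
    | cons b m =>
      simp only [commonPrefixLength]
      split_ifs with h
      · simp [h, ih m]
      · simp

end CommonPrefix

namespace FreeGroup

variable {α : Type*} [DecidableEq α]

theorem IsReduced.invRev {l : List (α × Bool)} (h : IsReduced l) : IsReduced (invRev l) := by
  rw [isReduced_iff_reduce_eq, reduce_invRev, h.reduce_eq]

theorem length_reduce_invRev_append {l m : List (α × Bool)} (hl : IsReduced l)
    (hm : IsReduced m) :
    (reduce (invRev l ++ m)).length + 2 * commonPrefixLength l m = l.length + m.length := by
  induction l generalizing m with
  | nil => simp [commonPrefixLength, hm.reduce_eq]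
  | cons a l ih =>
    cases m with
    | nil => simp [commonPrefixLength, hl.invRev.reduce_eq]
    | cons b m =>
      have hl' : IsReduced l := hl.infix ⟨[a], [], by simp⟩
      have hm' : IsReduced m := hm.infix ⟨[b], [], by simp⟩
      by_cases hab : a = b
      · subst hab
        have key : reduce (FreeGroup.invRev (a :: l) ++ a :: m)
            = reduce (FreeGroup.invRev l ++ m) := by
          apply reduce.sound
          rw [← mul_mk, ← mul_mk, ← inv_mk, ← inv_mk, ← List.singleton_append,
            ← List.singleton_append (l := m), ← mul_mk, ← mul_mk]
          group
        have := ih hl' hm'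
        simp only [key, commonPrefixLength, if_true, List.length_cons]
        omega
      · have hred : IsReduced (FreeGroup.invRev (a :: l) ++ b :: m) := by
          refine List.isChain_append.2 ⟨hl.invRev, hm, ?_⟩
          intro x hx y hy
          simp [FreeGroup.invRev] at hx hy
          subst hx hy
          intro h1
          by_contra h2
          exact hab (Prod.ext h1 (by simpa using h2))
        rw [hred.reduce_eq]
        simp [commonPrefixLength, hab]

/-- The Gromov product of two elements of a free group, based at the identity of the Cayley tree:
the length of the longest common prefix of their reduced words. -/
def gromovProduct (x y : FreeGroup α) : ℕ := commonPrefixLength x.toWord y.toWord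

theorem gromovProduct_comm (x y : FreeGroup α) : gromovProduct x y = gromovProduct y x :=
  commonPrefixLength_comm _ _

theorem min_gromovProduct_le (x y z : FreeGroup α) :
    min (gromovProduct x y) (gromovProduct y z) ≤ gromovProduct x z :=
  min_commonPrefixLength_le _ _ _

theorem norm_inv_mul (x y : FreeGroup α) :
    norm (x⁻¹ * y) + 2 * gromovProduct x y = norm x + norm y := by
  rw [norm, toWord_mul, toWord_inv]
  exact length_reduce_invRev_append isReduced_toWord isReduced_toWord

theorem norm_lt_norm_mul_self {x : FreeGroup α} (hx : x ≠ 1) : norm x < norm (x * x) := by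
  have h1 := congrArg List.length
    (reduceCyclically.conj_conjugator_reduceCyclically x.toWord)
  have h2 := congrArg List.length
    (reduceCyclically.reduce_flatten_replicate_succ (isReduced_toWord (x := x)) 1)
  rw [← toWord_pow] at h2
  have hne : (reduceCyclically x.toWord).length ≠ 0 := by
    intro h0
    apply hx
    rw [List.length_eq_zero_iff] at h0
    have h3 := reduceCyclically.conj_conjugator_reduceCyclically x.toWord
    rw [h0, List.append_nil] at h3
    rw [← mk_toWord (x := x), ← h3, ← mul_mk, ← inv_mk, mul_inv_cancel]
  rw [← pow_two]
  simp [norm] at h1 h2 ⊢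
  omega

theorem two_mul_gromovProduct_inv_self_lt {x : FreeGroup α} (hx : x ≠ 1) :
    2 * gromovProduct x⁻¹ x < norm x := by
  have h1 := norm_inv_mul x⁻¹ x
  have h2 := norm_lt_norm_mul_self hx
  rw [inv_inv, norm_inv_eq] at h1
  omega

/-- If half of `x` is a prefix of `y`, and half of `x⁻¹` is a prefix of `y⁻¹`, then `y` arises
from `x` by inserting a word in the middle. -/
theorem exists_eq_mul_of_two_mul_gromovProduct_eq {x y : FreeGroup α} (hxy : norm x ≤ norm y)
    (h1 : 2 * gromovProduct x y = norm x) (h2 : 2 * gromovProduct x⁻¹ y⁻¹ = norm x) :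
    ∃ p z q : FreeGroup α, x = p * q ∧ y = p * z * q ∧
      norm p + norm q ≤ norm x ∧ norm z + norm x ≤ norm y := by
  set k := gromovProduct x y with hk
  have h3 : gromovProduct x⁻¹ y⁻¹ = k := by omega
  have t1 : x.toWord.take k = y.toWord.take k := take_commonPrefixLength _ _
  have t2 : x⁻¹.toWord.take k = y⁻¹.toWord.take k := by
    rw [← h3]; exact take_commonPrefixLength _ _
  have hx : x.toWord.length = 2 * k := h1.symm
  have hy : 2 * k ≤ y.toWord.length := h1.le.trans hxy
  have t3 : x.toWord.drop k = y.toWord.drop (y.toWord.length - k) := by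
    rw [toWord_inv, toWord_inv] at t2
    simp only [invRev, List.take_reverse, List.length_map, List.reverse_inj, ← List.map_drop] at t2
    have hinj : Function.Injective (fun g : α × Bool => (g.1, !g.2)) := by
      intro a b hab
      simpa [Prod.ext_iff] using hab
    have := List.map_injective_iff.2 hinj t2
    rwa [hx, show 2 * k - k = k by omega] at this
  set l := x.toWord with hl
  set m := y.toWord with hm
  have ey : m.take k ++ (m.drop k).take (m.length - 2 * k) ++ m.drop (m.length - k) = m := by
    have : m.drop (m.length - k) = (m.drop k).drop (m.length - 2 * k) := by
      rw [List.drop_drop]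
      congr 1
      omega
    rw [this, List.append_assoc, List.take_append_drop, List.take_append_drop]
  refine ⟨mk (l.take k), mk ((m.drop k).take (m.length - 2 * k)), mk (l.drop k), ?_, ?_, ?_, ?_⟩
  · rw [mul_mk, List.take_append_drop, hl, mk_toWord]
  · rw [t1, t3, mul_mk, mul_mk, ey, hm, mk_toWord]
  · refine le_trans ?_ (List.length_append.symm.trans
      (congrArg List.length (List.take_append_drop k l))).le
    gcongr <;> exact norm_mk_le
  · have hz := norm_mk_le (L₁ := (m.drop k).take (m.length - 2 * k))
    change _ + l.length ≤ m.length
    simp only [List.length_take, List.length_drop] at hz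
    omega

/-- The image of a signed letter under a map from the generators. -/
def signedLetter {ι G : Type*} [Group G] (f : ι → G) (u : ι × Bool) : G :=
  cond u.2 (f u.1) (f u.1)⁻¹

theorem lift_eq_prod_signedLetter {ι G : Type*} [DecidableEq ι] [Group G] (f : ι → G)
    (w : FreeGroup ι) : lift f w = (w.toWord.map (signedLetter f)).prod := by
  conv_lhs => rw [← mk_toWord (x := w), lift_mk]
  rfl

/-- A family is Nielsen reduced (in the strict sense) if, in any product of two or three successive
letters of a reduced word, the cancellations leave a part of each letter. -/
def IsNielsenReduced {ι : Type*} (f : ι → FreeGroup α) : Prop :=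
  ∀ u v w : ι × Bool, (v.1 = u.1 → v.2 = u.2) → (u.1 = w.1 → u.2 = w.2) →
    gromovProduct (signedLetter f v)⁻¹ (signedLetter f u)
      + gromovProduct (signedLetter f u)⁻¹ (signedLetter f w) < norm (signedLetter f u)

theorem IsNielsenReduced.gromovProduct_prod {ι : Type*} {f : ι → FreeGroup α}
    (hf : IsNielsenReduced f) (L : List (ι × Bool)) (a v : ι × Bool) (hL : IsReduced (a :: L))
    (hv : v.1 = a.1 → v.2 = a.2) :
    gromovProduct (signedLetter f v)⁻¹ ((a :: L).map (signedLetter f)).prod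
        = gromovProduct (signedLetter f v)⁻¹ (signedLetter f a) ∧
      gromovProduct (signedLetter f v)⁻¹ (signedLetter f a) + (a :: L).length
        ≤ norm ((a :: L).map (signedLetter f)).prod := by
  induction L generalizing a v with
  | nil =>
    have := hf a v a hv (fun _ => rfl)
    simp
    omega
  | cons b L ih =>
    obtain ⟨hab, hbL⟩ := List.isChain_cons_cons.1 hL
    obtain ⟨e1, e2⟩ := ih b a hbL hab
    have hN := hf a v b hv hab
    rw [List.map_cons, List.prod_cons]
    set g := ((b :: L).map (signedLetter f)).prod
    set x := signedLetter f a
    set y := (signedLetter f v)⁻¹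
    have n1 := norm_inv_mul x⁻¹ g
    have n2 := norm_inv_mul (x * g) x
    rw [show (x * g)⁻¹ * x = g⁻¹ by group, norm_inv_eq] at n2
    rw [inv_inv, norm_inv_eq] at n1
    have m1 := min_gromovProduct_le y x (x * g)
    have m2 := min_gromovProduct_le y (x * g) x
    rw [gromovProduct_comm x (x * g)] at m1
    simp only [List.length_cons] at e2 ⊢
    omega

theorem IsNielsenReduced.length_le_norm_lift {ι : Type*} [DecidableEq ι] {f : ι → FreeGroup α}
    (hf : IsNielsenReduced f) (w : FreeGroup ι) : norm w ≤ norm (lift f w) := by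
  rw [lift_eq_prod_signedLetter, norm]
  have hred := isReduced_toWord (x := w)
  cases h : w.toWord with
  | nil => simp
  | cons a L =>
    have := (hf.gromovProduct_prod L a a (h ▸ hred) (fun _ => rfl)).2
    omega

theorem IsNielsenReduced.exists_eq_signedLetter {ι : Type*} {f : ι → FreeGroup α}
    (hf : IsNielsenReduced f) (hs : Function.Surjective (lift f)) (a : α) :
    ∃ u, of a = signedLetter f u := by
  classical
  obtain ⟨w, hw⟩ := hs (of a)
  have h1 := hf.length_le_norm_lift w
  rw [hw, norm_of] at h1
  match h : w.toWord with
  | [] =>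
    rw [toWord_eq_nil_iff] at h
    rw [h, _root_.map_one] at hw
    exact absurd hw (one_ne_of a)
  | [u] => exact ⟨u, by rw [← hw, lift_eq_prod_signedLetter, h]; simp⟩
  | _ :: _ :: _ =>
    rw [norm, h] at h1
    simp at h1

end FreeGroup

section CommutatorPairs

variable {G : Type*} [Group G]

/-- Conjugacy up to inversion. -/
def IsConjOrInv (a b : G) : Prop := IsConj a b ∨ IsConj a b⁻¹

theorem IsConj.inv_inv {a b : G} (h : IsConj a b) : IsConj a⁻¹ b⁻¹ := by
  obtain ⟨c, rfl⟩ := isConj_iff.1 h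
  exact isConj_iff.2 ⟨c, by group⟩

theorem IsConjOrInv.symm {a b : G} (h : IsConjOrInv a b) : IsConjOrInv b a := by
  rcases h with h | h
  · exact Or.inl h.symm
  · exact Or.inr (by simpa using h.symm.inv_inv)

theorem IsConjOrInv.trans {a b c : G} (h : IsConjOrInv a b) (h' : IsConjOrInv b c) :
    IsConjOrInv a c := by
  rcases h with h | h <;> rcases h' with h' | h'
  · exact Or.inl (h.trans h')
  · exact Or.inr (h.trans h')
  · exact Or.inr (h.trans h'.inv_inv)
  · exact Or.inl (h.trans (by simpa using h'.inv_inv))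

open scoped commutatorElement

theorem isConjOrInv_commutator_swap (x y : G) : IsConjOrInv ⁅y, x⁆ ⁅x, y⁆ :=
  Or.inr (by rw [commutatorElement_inv])

theorem isConjOrInv_commutator_inv_left (x y : G) : IsConjOrInv ⁅x⁻¹, y⁆ ⁅x, y⁆ :=
  Or.inr (isConj_iff.2 ⟨x, by simp only [commutatorElement_def]; group⟩)

theorem isConjOrInv_commutator_inv_mul (x y : G) : IsConjOrInv ⁅x, x⁻¹ * y⁆ ⁅x, y⁆ :=
  Or.inl (isConj_iff.2 ⟨x, by simp only [commutatorElement_def]; group⟩)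

theorem isConjOrInv_commutator_conj (g x y : G) :
    IsConjOrInv ⁅g * x * g⁻¹, g * y * g⁻¹⁆ ⁅x, y⁆ :=
  Or.inl (isConj_iff.2 ⟨g⁻¹, by simp only [commutatorElement_def]; group⟩)

theorem closure_pair_eq_top_of_mem {x y x' y' : G} (h : Subgroup.closure {x, y} = ⊤)
    (hx : x ∈ Subgroup.closure {x', y'}) (hy : y ∈ Subgroup.closure {x', y'}) :
    Subgroup.closure {x', y'} = ⊤ := by
  rw [eq_top_iff, ← h, Subgroup.closure_le]
  rintro z (rfl | rfl)
  exacts [hx, hy]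

theorem closure_pair_conj_eq_top {x y : G} (g : G) (h : Subgroup.closure {x, y} = ⊤) :
    Subgroup.closure {g * x * g⁻¹, g * y * g⁻¹} = ⊤ := by
  have := congrArg (Subgroup.map (MulAut.conj g).toMonoidHom) h
  rw [MonoidHom.map_closure, Set.image_pair,
    Subgroup.map_top_of_surjective _ (MulAut.conj g).surjective] at this
  simpa using this

/-- `(x, y)` generates `G`, and its commutator is conjugate to `c` or `c⁻¹`. -/
def GeneratesWithCommutator (c x y : G) : Prop :=
  Subgroup.closure {x, y} = ⊤ ∧ IsConjOrInv ⁅x, y⁆ c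

namespace GeneratesWithCommutator

variable {c x y : G}

theorem swap (h : GeneratesWithCommutator c x y) : GeneratesWithCommutator c y x :=
  ⟨by rw [Set.pair_comm]; exact h.1, (isConjOrInv_commutator_swap x y).trans h.2⟩

theorem inv_left (h : GeneratesWithCommutator c x y) : GeneratesWithCommutator c x⁻¹ y := by
  refine ⟨closure_pair_eq_top_of_mem h.1 ?_ (Subgroup.subset_closure (by simp)),
    (isConjOrInv_commutator_inv_left x y).trans h.2⟩
  exact inv_mem_iff.1 (Subgroup.subset_closure (by simp))

theorem inv_mul (h : GeneratesWithCommutator c x y) :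
    GeneratesWithCommutator c x (x⁻¹ * y) := by
  have hx : x ∈ Subgroup.closure {x, x⁻¹ * y} := Subgroup.subset_closure (by simp)
  refine ⟨closure_pair_eq_top_of_mem h.1 hx ?_, (isConjOrInv_commutator_inv_mul x y).trans h.2⟩
  simpa using mul_mem hx (Subgroup.subset_closure (by simp) :
    x⁻¹ * y ∈ Subgroup.closure {x, x⁻¹ * y})

theorem conj (g : G) (h : GeneratesWithCommutator c x y) :
    GeneratesWithCommutator c (g * x * g⁻¹) (g * y * g⁻¹) :=
  ⟨closure_pair_conj_eq_top g h.1, (isConjOrInv_commutator_conj g x y).trans h.2⟩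

end GeneratesWithCommutator

end CommutatorPairs

open FreeGroup

theorem A_mul_B_ne : A * B ≠ B * A := by
  unfold A B
  decide

/-- A generating pair of least total length among those with commutator conjugate to `c` or
`c⁻¹`. -/
def IsMinimalPair (c x y : F2) : Prop :=
  GeneratesWithCommutator c x y ∧
    ∀ x' y', GeneratesWithCommutator c x' y' → norm x + norm y ≤ norm x' + norm y'

namespace IsMinimalPair

variable {c x y : F2}

theorem swap (h : IsMinimalPair c x y) : IsMinimalPair c y x :=
  ⟨h.1.swap, fun x' y' h' => by rw [add_comm]; exact h.2 x' y' h'⟩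

theorem inv_left (h : IsMinimalPair c x y) : IsMinimalPair c x⁻¹ y :=
  ⟨h.1.inv_left, fun x' y' h' => by rw [norm_inv_eq]; exact h.2 x' y' h'⟩

theorem inv_right (h : IsMinimalPair c x y) : IsMinimalPair c x y⁻¹ :=
  h.swap.inv_left.swap

theorem ne_one (h : IsMinimalPair c x y) : x ≠ 1 := by
  rintro rfl
  have hy : ∀ g : F2, g ∈ Subgroup.zpowers y := by
    intro g
    have := h.1.1
    rw [Subgroup.closure_insert_one, ← Subgroup.zpowers_eq_closure] at this
    rw [this]
    trivial
  obtain ⟨m, hm⟩ := hy A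
  obtain ⟨n, hn⟩ := hy B
  apply A_mul_B_ne
  rw [← hm, ← hn]
  exact (Commute.zpow_zpow_self y m n).eq

theorem two_mul_gromovProduct_le (h : IsMinimalPair c x y) : 2 * gromovProduct x y ≤ norm x := by
  have h1 := h.2 _ _ h.1.inv_mul
  have h2 := norm_inv_mul x y
  omega

theorem not_two_mul_gromovProduct_eq (h : IsMinimalPair c x y) :
    ¬ (2 * gromovProduct x y = norm x ∧ 2 * gromovProduct x⁻¹ y⁻¹ = norm x) := by
  rintro ⟨h1, h2⟩
  have hxy : norm x ≤ norm y := by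
    have := h.swap.two_mul_gromovProduct_le
    rw [gromovProduct_comm] at this
    omega
  obtain ⟨p, z, q, rfl, rfl, hpq, hz⟩ := exists_eq_mul_of_two_mul_gromovProduct_eq hxy h1 h2
  have h3 := h.2 _ _ (h.1.inv_mul.conj q)
  rw [show q * (p * q) * q⁻¹ = q * p by group,
    show q * ((p * q)⁻¹ * (p * z * q)) * q⁻¹ = z by group] at h3
  have h4 := norm_mul_le q p
  have h5 : norm (p * q) ≠ 0 := fun h0 => h.ne_one (norm_eq_zero.1 h0)
  omega

theorem gromovProduct_add_lt (h : IsMinimalPair c x y) {v w : F2}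
    (hv : v = x ∨ v = y ∨ v = y⁻¹) (hw : w = x ∨ w = y ∨ w = y⁻¹) :
    gromovProduct v⁻¹ x + gromovProduct x⁻¹ w < norm x := by
  have h0 := two_mul_gromovProduct_inv_self_lt h.ne_one
  have h1 := h.two_mul_gromovProduct_le
  have h2 := h.inv_right.two_mul_gromovProduct_le
  have h3 := h.inv_left.two_mul_gromovProduct_le
  have h4 := h.inv_left.inv_right.two_mul_gromovProduct_le
  have h5 := h.not_two_mul_gromovProduct_eq
  have h6 := h.inv_right.not_two_mul_gromovProduct_eq
  have m1 := min_gromovProduct_le x y x⁻¹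
  have m2 := min_gromovProduct_le x y⁻¹ x⁻¹
  rw [gromovProduct_comm x x⁻¹, gromovProduct_comm _ x⁻¹] at m1 m2
  rw [norm_inv_eq] at h3 h4
  rw [inv_inv] at h6
  have c1 := gromovProduct_comm x y
  have c2 := gromovProduct_comm x y⁻¹
  rcases hv with rfl | rfl | rfl <;> rcases hw with rfl | rfl | rfl <;>
    (try rw [inv_inv]) <;> omega

theorem isNielsenReduced (h : IsMinimalPair c x y) :
    IsNielsenReduced (fun b : Bool => cond b x y) := by
  have key : ∀ u : Bool × Bool, IsMinimalPair c (signedLetter (fun b : Bool => cond b x y) u)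
      (signedLetter (fun b : Bool => cond b x y) (!u.1, true)) := by
    rintro ⟨_ | _, _ | _⟩
    exacts [h.swap.inv_left, h.swap, h.inv_left, h]
  intro u v w hv hw
  refine (key u).gromovProduct_add_lt ?_ ?_
  · rcases u with ⟨_ | _, _ | _⟩ <;> rcases v with ⟨_ | _, _ | _⟩ <;>
      simp [signedLetter] at hv ⊢
  · rcases u with ⟨_ | _, _ | _⟩ <;> rcases w with ⟨_ | _, _ | _⟩ <;>
      simp [signedLetter] at hw ⊢

open scoped commutatorElement

theorem isConjOrInv_commutator (h : IsMinimalPair c x y) : IsConjOrInv ⁅A, B⁆ c := by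
  have hs : Function.Surjective (lift (fun b : Bool => cond b x y)) := by
    rw [← MonoidHom.range_eq_top, range_lift_eq_closure, ← h.1.1]
    congr 1
    ext z
    simp [or_comm, eq_comm]
  obtain ⟨u, hu⟩ := h.isNielsenReduced.exists_eq_signedLetter hs true
  obtain ⟨v, hv⟩ := h.isNielsenReduced.exists_eq_signedLetter hs false
  have hAB := A_mul_B_ne
  change A = _ at hu
  change B = _ at hv
  rw [hu, hv] at hAB ⊢
  rcases u with ⟨_ | _, _ | _⟩ <;> rcases v with ⟨_ | _, _ | _⟩ <;>
    simp [signedLetter] at hAB ⊢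
  exacts [h.inv_left.inv_right.swap.1.2, h.inv_right.swap.1.2, h.inv_left.swap.1.2, h.swap.1.2,
    h.inv_left.inv_right.1.2, h.inv_left.1.2, h.inv_right.1.2, h.1.2]

end IsMinimalPair

theorem GeneratesWithCommutator.exists_isMinimalPair {c x y : F2}
    (h : GeneratesWithCommutator c x y) : ∃ x' y', IsMinimalPair c x' y' := by
  obtain ⟨p, hp, hmin⟩ := (measure fun p : F2 × F2 => norm p.1 + norm p.2).wf.has_min
    {p | GeneratesWithCommutator c p.1 p.2} ⟨(x, y), h⟩
  exact ⟨p.1, p.2, hp, fun x' y' h' => not_lt.1 (hmin (x', y') h')⟩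

theorem IsBasis.closure_eq_top {x y : F2} (h : IsBasis x y) : Subgroup.closure {x, y} = ⊤ := by
  obtain ⟨e, rfl, rfl⟩ := h
  have hr : Set.range (of : Bool → F2) = {A, B} := by
    ext z
    simp [A, B, or_comm]
  have := congrArg (Subgroup.map e.toMonoidHom) (closure_range_of Bool)
  rw [MonoidHom.map_closure, hr, Set.image_pair,
    Subgroup.map_top_of_surjective _ e.surjective] at this
  simpa using this

theorem stmt_17 (X Y : F2) (h : IsBasis X Y) :
    IsConj (X * Y * X⁻¹ * Y⁻¹) (A * B * A⁻¹ * B⁻¹) ∨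
      IsConj (X * Y * X⁻¹ * Y⁻¹) (B * A * B⁻¹ * A⁻¹) := by
  have h0 : GeneratesWithCommutator (X * Y * X⁻¹ * Y⁻¹) X Y :=
    ⟨h.closure_eq_top, Or.inl (IsConj.refl _)⟩
  obtain ⟨x, y, hmin⟩ := h0.exists_isMinimalPair
  refine hmin.isConjOrInv_commutator.symm.imp id fun h' => ?_
  rwa [commutatorElement_inv] at h'
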